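/- Let 1 ≤ p < ∞, let ρ ⊆ [0,1) have 1 as a limit point, and let K ⊆ 𝕋 be compact with m(K) = 0. Then 𝒱_{H^p}^K(𝔻,ρ) = ⋂_{j∈ℕ, s∈ℕ*} ⋃_{r∈ρ} U(j,s,r). -/

import Mathlib

open Complex Metric Set Filter MeasureTheory Polynomial Topology

noncomputable section

/-- The Hardy `p`-norm of a function `f` on the unit disk:
`sup_{0<r<1} ((1/2π) ∫_0^{2π} |f(r e^{iθ})|^p dθ)^{1/p}`. -/
def hardyNorm (p : ℝ) (f : ℂ → ℂ) : ℝ :=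
  ⨆ r : Set.Ioo (0:ℝ) 1,
    ((1 / (2 * Real.pi)) *
      ∫ θ in (0:ℝ)..(2 * Real.pi),
        ‖f (((r : ℝ) : ℂ) * Complex.exp ((θ : ℂ) * Complex.I))‖ ^ p) ^ (1 / p)

/-- Membership in the Hardy space `H^p(𝔻)`: `f` is holomorphic on the unit disk and the
means `((1/2π) ∫_0^{2π} |f(r e^{iθ})|^p dθ)^{1/p}` are uniformly bounded for `0 < r < 1`. -/
def MemHp (p : ℝ) (f : ℂ → ℂ) : Prop :=
  DifferentiableOn ℂ f (Metric.ball (0:ℂ) 1) ∧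
  BddAbove (Set.range fun r : Set.Ioo (0:ℝ) 1 =>
    ((1 / (2 * Real.pi)) *
      ∫ θ in (0:ℝ)..(2 * Real.pi),
        ‖f (((r : ℝ) : ℂ) * Complex.exp ((θ : ℂ) * Complex.I))‖ ^ p) ^ (1 / p))

/-- The Hardy space `H^p(𝔻)` as a type. -/
def HpSpace (p : ℝ) := {f : ℂ → ℂ // MemHp p f}

/-- The norm topology on `H^p(𝔻)`, generated by the open balls of the Hardy norm. -/
instance hpTopology (p : ℝ) : TopologicalSpace (HpSpace p) :=
  TopologicalSpace.generateFrom
    {U : Set (HpSpace p) | ∃ (f : HpSpace p) (ε : ℝ), 0 < ε ∧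
      U = {g : HpSpace p | hardyNorm p (fun z => g.1 z - f.1 z) < ε}}

/-- The arc length measure of a subset `K` of the unit circle `𝕋 ⊆ ℂ`, computed as the
Lebesgue measure of the set of angles `θ ∈ [0, 2π)` with `e^{iθ} ∈ K`. -/
def arcMeasure (K : Set ℂ) : ENNReal :=
  MeasureTheory.volume {θ : ℝ | θ ∈ Set.Ico (0:ℝ) (2 * Real.pi) ∧
    Complex.exp ((θ : ℂ) * Complex.I) ∈ K}

/-- The class `𝒱_{H^p}^K(𝔻,ρ)` of functions in `H^p(𝔻)` with universal radial limits on `K`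
along dilation parameters from `ρ`. -/
def VHp (p : ℝ) (ρ : Set ℝ) (K : Set ℂ) : Set (HpSpace p) :=
  {f : HpSpace p | ∀ φ : ℂ → ℂ, ContinuousOn φ K →
    ∀ L : Set ℂ, IsCompact L → L ⊆ Metric.ball (0:ℂ) 1 →
      ∃ r : ℕ → ℝ, (∀ n, r n ∈ ρ) ∧ StrictMono r ∧
        Filter.Tendsto r Filter.atTop (nhds 1) ∧
        Filter.Tendsto
          (fun n => ⨆ ζ ∈ K, ⨆ z ∈ L, ‖f.1 (((r n : ℝ) : ℂ) * (ζ - z) + z) - φ ζ‖)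
          Filter.atTop (nhds 0)}

/-- A complex polynomial has rational coefficients if the real and imaginary part of each
coefficient is rational. -/
def RatPoly (q : Polynomial ℂ) : Prop :=
  ∀ n : ℕ, ∃ a b : ℚ, q.coeff n = (a : ℂ) + (b : ℂ) * Complex.I

/-- The set `U(j,s,r)` of `f ∈ H^p(𝔻)` with
`sup_{ζ∈K} sup_{|z| ≤ s/(s+1)} |f(r(ζ-z)+z) - P_j(ζ)| < 1/s`. -/
def UHp (p : ℝ) (K : Set ℂ) (P : ℕ → Polynomial ℂ) (j s : ℕ) (r : ℝ) :
    Set (HpSpace p) :=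
  {f : HpSpace p |
    (⨆ ζ ∈ K, ⨆ z ∈ Metric.closedBall (0:ℂ) ((s : ℝ) / ((s : ℝ) + 1)),
      ‖f.1 ((r : ℂ) * (ζ - z) + z) - (P j).eval ζ‖) < 1 / (s : ℝ)}

/-- If a ray from `0` misses the compact set `K`, then the coordinate function is invertible in the
uniform closure of the polynomials. -/
theorem exists_X_mul_eq_one_of_ray_disjoint {K : Set ℂ} [CompactSpace K] {w : ℂ} (hw : w ≠ 0)
    (hray : ∀ t : ℝ, 0 ≤ t → (t : ℂ) * w ∉ K) :
    ∃ g ∈ (polynomialFunctions K).topologicalClosure,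
      toContinuousMapOnAlgHom K X * g = 1 := by
  set A := (polynomialFunctions K).topologicalClosure
  have hX : toContinuousMapOnAlgHom K X ∈ A :=
    (polynomialFunctions K).le_topologicalClosure
      (by rw [polynomialFunctions.eq_adjoin_X]; exact Algebra.subset_adjoin rfl)
  let x : A := ⟨_, hX⟩
  have : IsClosed (A : Set C(K, ℂ)) := (polynomialFunctions K).isClosed_topologicalClosure
  have hspec : spectrum ℂ (x : C(K, ℂ)) = K := by
    rw [ContinuousMap.spectrum_eq_range]
    ext z
    simp [x]
  have hx : (0 : ℂ) ∉ spectrum ℂ x := by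
    intro h0
    have hb := Subalgebra.spectrum_isBounded_connectedComponentIn A x h0
    rw [hspec] at hb
    have hconn : IsPreconnected ((fun t : ℝ => (t : ℂ) * w) '' Ici 0) :=
      isPreconnected_Ici.image _ (by fun_prop)
    have hsub := hconn.subset_connectedComponentIn (x := 0) (F := Kᶜ) ⟨0, by simp, by simp⟩
      (by rintro _ ⟨t, ht, rfl⟩; exact hray t ht)
    obtain ⟨R, hR⟩ := (hb.subset hsub).exists_norm_le
    have hwpos : 0 < ‖w‖ := norm_pos_iff.2 hw
    have h1 := hR _ ⟨(|R| + 1) / ‖w‖, by simp only [mem_Ici]; positivity, rfl⟩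
    rw [norm_mul, Complex.norm_real, Real.norm_of_nonneg (by positivity),
      div_mul_cancel₀ _ hwpos.ne'] at h1
    linarith [le_abs_self R]
  rw [spectrum.zero_notMem_iff] at hx
  obtain ⟨g, hg⟩ := hx.exists_right_inv
  exact ⟨g, g.2, congrArg Subtype.val hg⟩

/-- Polynomials are uniformly dense in the continuous functions on a compact proper subset of the
unit circle. -/
theorem polynomialFunctions_topologicalClosure_of_subset_sphere {K : Set ℂ} [CompactSpace K]
    (hK : K ⊆ sphere 0 1) {w : ℂ} (hw : w ∈ sphere (0 : ℂ) 1) (hwK : w ∉ K) :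
    (polynomialFunctions K).topologicalClosure = ⊤ := by
  have hwn : ‖w‖ = 1 := by simpa using hw
  obtain ⟨g, hgA, hg⟩ := exists_X_mul_eq_one_of_ray_disjoint (K := K) (w := w)
    (by rintro rfl; simp at hwn) (by
      intro t ht h
      have := hK h
      rw [mem_sphere_zero_iff_norm, norm_mul, hwn, Complex.norm_real, Real.norm_of_nonneg ht,
        mul_one] at this
      exact hwK (by simpa [this] using h))
  have hstar : star (toContinuousMapOnAlgHom K X) = g := by
    ext z
    have hz : ‖(z : ℂ)‖ = 1 := by simpa using hK z.2
    have h1 : (z : ℂ) * g z = 1 := by simpa using congrArg (fun h : C(K, ℂ) => h z) hg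
    have h2 : (z : ℂ) * star (z : ℂ) = 1 := by
      simp [Complex.mul_conj, Complex.normSq_eq_norm_sq, hz]
    have hz0 : (z : ℂ) ≠ 0 := by rintro h; simp [h] at hz
    simpa using mul_left_cancel₀ hz0 (h2.trans h1.symm)
  have hle : ((polynomialFunctions K).starClosure : Set C(K, ℂ)) ⊆
      (polynomialFunctions K).topologicalClosure := by
    rw [polynomialFunctions.starClosure_eq_adjoin_X]
    rw [← StarSubalgebra.coe_toSubalgebra, StarAlgebra.adjoin_toSubalgebra,
      SetLike.coe_subset_coe, Algebra.adjoin_le_iff, Set.star_singleton, hstar]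
    rintro f (rfl | rfl)
    · exact (polynomialFunctions K).le_topologicalClosure
        (by rw [polynomialFunctions.eq_adjoin_X]; exact Algebra.subset_adjoin rfl)
    · exact hgA
  rw [eq_top_iff]
  intro f _
  have hf : f ∈ (polynomialFunctions K).starClosure.topologicalClosure := by
    rw [polynomialFunctions.starClosure_topologicalClosure]; trivial
  exact closure_minimal hle (polynomialFunctions K).isClosed_topologicalClosure hf

theorem exists_polynomial_near_of_subset_sphere {K : Set ℂ} (hKc : IsCompact K)
    (hK : K ⊆ sphere 0 1) {w : ℂ} (hw : w ∈ sphere (0 : ℂ) 1) (hwK : w ∉ K) {φ : ℂ → ℂ}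
    (hφ : ContinuousOn φ K) {ε : ℝ} (hε : 0 < ε) :
    ∃ q : ℂ[X], ∀ ζ ∈ K, ‖q.eval ζ - φ ζ‖ < ε := by
  have := isCompact_iff_compactSpace.1 hKc
  let F : C(K, ℂ) := ⟨K.domRestrict φ, hφ.domRestrict⟩
  have hF : F ∈ (polynomialFunctions K).topologicalClosure := by
    rw [polynomialFunctions_topologicalClosure_of_subset_sphere hK hw hwK]; trivial
  obtain ⟨_, ⟨q, -, rfl⟩, hq⟩ := Metric.mem_closure_iff.1 hF ε hε
  refine ⟨q, fun ζ hζ => ?_⟩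
  have := (ContinuousMap.dist_lt_iff hε).1 hq ⟨ζ, hζ⟩
  rw [dist_comm, dist_eq_norm] at this
  exact this

theorem RatPoly.add {q₁ q₂ : ℂ[X]} (h₁ : RatPoly q₁) (h₂ : RatPoly q₂) : RatPoly (q₁ + q₂) := by
  intro n
  obtain ⟨a, b, h⟩ := h₁ n
  obtain ⟨a', b', h'⟩ := h₂ n
  exact ⟨a + a', b + b', by rw [coeff_add, h, h']; push_cast; ring⟩

theorem ratPoly_monomial (n : ℕ) (a b : ℚ) :
    RatPoly (monomial n ((a : ℂ) + (b : ℂ) * Complex.I)) := by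
  intro m
  rw [coeff_monomial]
  split_ifs
  · exact ⟨a, b, rfl⟩
  · exact ⟨0, 0, by simp⟩

/-- Polynomials with rational coefficients are uniformly dense in the polynomials on the closed
unit disk. -/
theorem exists_ratPoly_near (q : ℂ[X]) : ∀ {ε : ℝ}, 0 < ε →
    ∃ q' : ℂ[X], RatPoly q' ∧ ∀ ζ : ℂ, ‖ζ‖ ≤ 1 → ‖q'.eval ζ - q.eval ζ‖ < ε := by
  induction q using Polynomial.induction_on' with
  | add q₁ q₂ h₁ h₂ =>
    intro ε hε
    obtain ⟨p₁, hp₁, hd₁⟩ := h₁ (half_pos hε)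
    obtain ⟨p₂, hp₂, hd₂⟩ := h₂ (half_pos hε)
    refine ⟨p₁ + p₂, hp₁.add hp₂, fun ζ hζ => ?_⟩
    rw [eval_add, eval_add, add_sub_add_comm]
    linarith [norm_add_le (p₁.eval ζ - q₁.eval ζ) (p₂.eval ζ - q₂.eval ζ), hd₁ ζ hζ, hd₂ ζ hζ]
  | monomial n c =>
    intro ε hε
    obtain ⟨a, ha⟩ := exists_rat_near c.re (half_pos hε)
    obtain ⟨b, hb⟩ := exists_rat_near c.im (half_pos hε)
    refine ⟨_, ratPoly_monomial n a b, fun ζ hζ => ?_⟩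
    rw [eval_monomial, eval_monomial, ← sub_mul, norm_mul, norm_pow]
    have h1 : ‖((a : ℂ) + (b : ℂ) * Complex.I) - c‖ < ε := by
      refine (Complex.norm_le_abs_re_add_abs_im _).trans_lt ?_
      rw [abs_sub_comm] at ha hb
      simp
      linarith
    exact (mul_le_of_le_one_right (norm_nonneg _) (pow_le_one₀ (norm_nonneg _) hζ)).trans_lt h1

theorem exists_mem_sphere_notMem_of_arcMeasure_eq_zero {K : Set ℂ} (hK : arcMeasure K = 0) :
    ∃ w ∈ sphere (0 : ℂ) 1, w ∉ K := by
  by_contra! h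
  have hset : {θ : ℝ | θ ∈ Set.Ico (0:ℝ) (2 * Real.pi) ∧
      Complex.exp ((θ : ℂ) * Complex.I) ∈ K} = Set.Ico 0 (2 * Real.pi) := by
    ext θ
    exact ⟨And.left, fun hθ => ⟨hθ, h _ (by simp [Complex.norm_exp_ofReal_mul_I])⟩⟩
  rw [arcMeasure, hset, Real.volume_Ico, ENNReal.ofReal_eq_zero] at hK
  linarith [Real.pi_pos]

theorem le_biSup_biSup {α β : Type*} {K : Set α} {L : Set β} {g : α → β → ℝ} {M : ℝ}
    (hM0 : 0 ≤ M) (hM : ∀ x ∈ K, ∀ y ∈ L, g x y ≤ M) {x : α} (hx : x ∈ K) {y : β} (hy : y ∈ L) :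
    g x y ≤ ⨆ x ∈ K, ⨆ y ∈ L, g x y := by
  have hinner : ∀ x ∈ K, ∀ y, ⨆ (_ : y ∈ L), g x y ≤ M := fun x hx y =>
    Real.iSup_le (fun hy => hM x hx y hy) hM0
  have houter : ∀ x, ⨆ (_ : x ∈ K), ⨆ y ∈ L, g x y ≤ M := fun x =>
    Real.iSup_le (fun hx => Real.iSup_le (hinner x hx) hM0) hM0
  calc g x y = ⨆ (_ : y ∈ L), g x y := by simp [hy]
    _ ≤ ⨆ y ∈ L, g x y :=
      le_ciSup (f := fun y => ⨆ (_ : y ∈ L), g x y) ⟨M, by rintro _ ⟨y, rfl⟩; exact hinner x hx y⟩ y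
    _ = ⨆ (_ : x ∈ K), ⨆ y ∈ L, g x y := by simp [hx]
    _ ≤ ⨆ x ∈ K, ⨆ y ∈ L, g x y :=
      le_ciSup (f := fun x => ⨆ (_ : x ∈ K), ⨆ y ∈ L, g x y)
        ⟨M, by rintro _ ⟨x, rfl⟩; exact houter x⟩ x

theorem norm_dilation_le {r : ℝ} (hr : r ∈ Icc (0 : ℝ) 1) {ζ z : ℂ} (hζ : ‖ζ‖ = 1) :
    ‖(r : ℂ) * (ζ - z) + z‖ ≤ r + (1 - r) * ‖z‖ := by
  have h : (r : ℂ) * (ζ - z) + z = r * ζ + ((1 - r : ℝ) : ℂ) * z := by push_cast; ring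
  rw [h]
  refine (norm_add_le _ _).trans_eq ?_
  rw [norm_mul, norm_mul, hζ, Complex.norm_real, Complex.norm_real, Real.norm_of_nonneg hr.1,
    Real.norm_of_nonneg (sub_nonneg.2 hr.2), mul_one]

theorem dilation_mem_ball {r : ℝ} (hr : r ∈ Ico (0 : ℝ) 1) {ζ z : ℂ} (hζ : ‖ζ‖ = 1)
    (hz : ‖z‖ < 1) : (r : ℂ) * (ζ - z) + z ∈ ball (0 : ℂ) 1 := by
  rw [mem_ball_zero_iff]
  have := norm_dilation_le (z := z) ⟨hr.1, hr.2.le⟩ hζ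
  nlinarith [hr.2]

/-- The supremum defining `UHp` is a genuine one, so it bounds each of its terms. -/
theorem norm_sub_lt_of_mem_UHp {p : ℝ} {K : Set ℂ} (hKc : IsCompact K)
    (hKT : K ⊆ sphere (0 : ℂ) 1) {P : ℕ → ℂ[X]} {j s : ℕ} {r : ℝ} (hr : r ∈ Ico (0 : ℝ) 1)
    {f : HpSpace p} (hf : f ∈ UHp p K P j s r) {ζ z : ℂ} (hζ : ζ ∈ K)
    (hz : ‖z‖ ≤ (s : ℝ) / ((s : ℝ) + 1)) :
    ‖f.1 ((r : ℂ) * (ζ - z) + z) - (P j).eval ζ‖ < 1 / (s : ℝ) := by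
  have hs : (s : ℝ) / ((s : ℝ) + 1) < 1 := (div_lt_one (by positivity)).2 (lt_add_one _)
  have hcont : ContinuousOn
      (fun x : ℂ × ℂ => ‖f.1 ((r : ℂ) * (x.1 - x.2) + x.2) - (P j).eval x.1‖)
      (K ×ˢ closedBall (0 : ℂ) ((s : ℝ) / ((s : ℝ) + 1))) := by
    refine ContinuousOn.norm (ContinuousOn.sub
      (f.2.1.continuousOn.comp (by fun_prop) ?_) (by fun_prop))
    rintro ⟨x, y⟩ ⟨hx, hy⟩
    exact dilation_mem_ball hr (by simpa using hKT hx)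
      ((mem_closedBall_zero_iff.1 hy).trans_lt hs)
  obtain ⟨M, hM⟩ := (hKc.prod (isCompact_closedBall _ _)).bddAbove_image hcont
  refine (le_biSup_biSup (M := max M 0)
    (g := fun ζ z => ‖f.1 ((r : ℂ) * (ζ - z) + z) - (P j).eval ζ‖) (le_max_right _ _) ?_ hζ
    (mem_closedBall_zero_iff.2 hz)).trans_lt hf
  exact fun x hx y hy => (hM ⟨(x, y), ⟨hx, hy⟩, rfl⟩).trans (le_max_left _ _)

/-- If the dilated functions `z ↦ f (r n * (ζ - z) + z)` tend to a constant while `r n` stays away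
from `1`, then `f` is constant. -/
theorem eqOn_const_of_tendsto_dilation {f : ℂ → ℂ} (hf : DifferentiableOn ℂ f (ball 0 1))
    {ζ c : ℂ} (hζ : ‖ζ‖ = 1) {a : ℝ} (ha : a < 1) {r : ℕ → ℝ} (hr : ∀ n, r n ∈ Icc 0 a)
    (h : ∀ z ∈ ball (0 : ℂ) 1,
      Tendsto (fun n => f ((r n : ℂ) * (ζ - z) + z)) atTop (𝓝 c)) :
    EqOn f (fun _ => c) (ball 0 1) := by
  obtain ⟨t, ht, u, hu, hut⟩ := isCompact_Icc.tendsto_subseq hr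
  have ht1 : t ∈ Ico (0 : ℝ) 1 := ⟨ht.1, ht.2.trans_lt ha⟩
  have hconst : ∀ z ∈ ball (0 : ℂ) 1, f ((t : ℂ) * (ζ - z) + z) = c := by
    intro z hz
    have hmem := dilation_mem_ball ht1 hζ (mem_ball_zero_iff.1 hz)
    have hcont := (hf.differentiableAt (isOpen_ball.mem_nhds hmem)).continuousAt
    have htend : Tendsto (fun n => (((r ∘ u) n : ℝ) : ℂ) * (ζ - z) + z) atTop
        (𝓝 ((t : ℂ) * (ζ - z) + z)) :=
      (((Complex.continuous_ofReal.tendsto t).comp hut).mul_const _).add_const _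
    exact tendsto_nhds_unique (hcont.tendsto.comp htend) ((h z hz).comp hu.tendsto_atTop)
  have h0 := dilation_mem_ball (z := 0) ht1 hζ (by simp)
  refine (hf.analyticOnNhd isOpen_ball).eqOn_of_preconnected_of_eventuallyEq
    analyticOnNhd_const (convex_ball _ _).isPreconnected h0 ?_
  have ht' : ((1 - t : ℝ) : ℂ) ≠ 0 := Complex.ofReal_ne_zero.2 (sub_pos.2 ht1.2).ne'
  have hinv : ContinuousAt (fun w : ℂ => (w - t * ζ) / ((1 - t : ℝ) : ℂ))
      ((t : ℂ) * (ζ - 0) + 0) := by fun_prop (disch := assumption)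
  filter_upwards [hinv.preimage_mem_nhds (isOpen_ball.mem_nhds (x := _) (s := ball (0 : ℂ) 1)
    (by simp))] with w hw
  have := hconst _ hw
  rwa [show (t : ℂ) * (ζ - (w - t * ζ) / ((1 - t : ℝ) : ℂ)) + (w - t * ζ) / ((1 - t : ℝ) : ℂ) = w by
    have hd := div_mul_cancel₀ (w - t * ζ) ht'
    push_cast at hd ⊢
    linear_combination hd] at this

/-- For a member of `⋂ j s, ⋃ r ∈ ρ, U(j, s, r)` the parameter `r` can be taken arbitrarily close
to `1`, at the price of enlarging `s`. -/
theorem exists_mem_UHp_near_one {p : ℝ} {ρ : Set ℝ} (hρ : ρ ⊆ Ico (0 : ℝ) 1) {K : Set ℂ}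
    (hKc : IsCompact K) (hKT : K ⊆ sphere (0 : ℂ) 1) (hK : K.Nonempty) {P : ℕ → ℂ[X]}
    (hP : ∀ q : ℂ[X], RatPoly q → ∃ j, P j = q) {f : HpSpace p}
    (hf : ∀ j s : ℕ, 1 ≤ s → ∃ r ∈ ρ, f ∈ UHp p K P j s r) (j s₀ : ℕ) {a : ℝ} (ha : a < 1) :
    ∃ s, s₀ ≤ s ∧ 1 ≤ s ∧ ∃ r ∈ ρ, a < r ∧ f ∈ UHp p K P j s r := by
  by_contra! hcon
  obtain ⟨ζ, hζ⟩ := hK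
  have hζ1 : ‖ζ‖ = 1 := by simpa using hKT hζ
  choose r hrρ hrU using fun n : ℕ => hf j (s₀ + n + 1) (by omega)
  have hra : ∀ n, r n ∈ Icc 0 a := fun n => ⟨(hρ (hrρ n)).1, by
    by_contra! h
    exact hcon (s₀ + n + 1) (by omega) (by omega) _ (hrρ n) h (hrU n)⟩
  have hlim : Tendsto (fun n : ℕ => 1 / ((s₀ + n + 1 : ℕ) : ℝ)) atTop (𝓝 0) :=
    (tendsto_const_div_atTop_nhds_zero_nat 1).comp
      (tendsto_atTop_mono (fun n => by simp only [id]; omega) tendsto_id)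
  have hconst : EqOn f.1 (fun _ => (P j).eval ζ) (ball 0 1) := by
    refine eqOn_const_of_tendsto_dilation f.2.1 hζ1 ha hra fun z hz => ?_
    rw [tendsto_iff_norm_sub_tendsto_zero]
    refine squeeze_zero' (Eventually.of_forall fun _ => norm_nonneg _) ?_ hlim
    filter_upwards [hlim.eventually_lt_const (sub_pos.2 (mem_ball_zero_iff.1 hz))] with n hn
    refine (norm_sub_lt_of_mem_UHp hKc hKT (hρ (hrρ n)) (hrU n) hζ ?_).le
    set x : ℝ := ((s₀ + n + 1 : ℕ) : ℝ)
    have hx : 0 < x := by positivity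
    rw [le_div_iff₀ (by positivity)]
    rw [div_lt_iff₀ hx] at hn
    nlinarith [norm_nonneg z]
  have hclose : ∀ b : ℚ, ‖(P j).eval ζ - (b : ℂ)‖ < 1 := by
    intro b
    obtain ⟨i, hi⟩ := hP (monomial 0 ((b : ℂ) + ((0 : ℚ) : ℂ) * Complex.I)) (ratPoly_monomial 0 b 0)
    obtain ⟨t, ht, htU⟩ := hf i 1 le_rfl
    have := norm_sub_lt_of_mem_UHp hKc hKT (hρ ht) htU hζ (z := 0) (by simp)
    rw [hconst (dilation_mem_ball (hρ ht) hζ1 (by simp)), hi] at this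
    simpa using this
  have h0 := hclose 0
  have h2 := hclose 2
  have := norm_sub_le ((P j).eval ζ - ((0 : ℚ) : ℂ)) ((P j).eval ζ - ((2 : ℚ) : ℂ))
  rw [sub_sub_sub_cancel_left] at this
  norm_num at this h0 h2
  linarith

theorem AccPt.exists_mem_gt {ρ : Set ℝ} {b : ℝ} (hb : AccPt b (𝓟 ρ)) {a : ℝ}
    (ha : a < b) : ∃ r ∈ ρ, a < r := by
  obtain ⟨r, ⟨-, hr⟩, har⟩ :=
    ((accPt_iff_frequently.1 hb).and_eventually (lt_mem_nhds ha)).exists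
  exact ⟨r, hr, har⟩

/-- A strictly increasing sequence tending to `b` whose `n`-th term satisfies the `n`-th of a
sequence of properties, each of which holds at points arbitrarily close to `b` on the left. -/
theorem exists_strictMono_tendsto_of_forall_exists_gt {b : ℝ} {Q : ℕ → ℝ → Prop}
    (h : ∀ n, ∀ a < b, ∃ r, a < r ∧ r < b ∧ Q n r) :
    ∃ r : ℕ → ℝ, StrictMono r ∧ Tendsto r atTop (𝓝 b) ∧ ∀ n, Q n (r n) := by
  have h' : ∀ (n : ℕ) (a : Iio b), ∃ r : Iio b,
      (a : ℝ) < r ∧ b - 1 / ((n : ℝ) + 1) < r ∧ Q n r := by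
    intro n a
    obtain ⟨r, har, hrb, hr⟩ := h n (max a (b - 1 / ((n : ℝ) + 1)))
      (max_lt a.2 (sub_lt_self _ (by positivity)))
    exact ⟨⟨r, hrb⟩, (le_max_left _ _).trans_lt har, (le_max_right _ _).trans_lt har, hr⟩
  choose F hF1 hF2 hF3 using h'
  let u : ℕ → Iio b := fun n =>
    Nat.rec (motive := fun _ => Iio b) (F 0 ⟨b - 1, sub_one_lt b⟩) (fun n x => F (n + 1) x) n
  have hlow : ∀ n : ℕ, b - 1 / ((n : ℝ) + 1) < (u n).1 := fun n => by
    cases n with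
    | zero => exact hF2 0 _
    | succ n => exact hF2 (n + 1) _
  have hmono : StrictMono fun n => (u n).1 :=
    strictMono_nat_of_lt_succ fun n => hF1 (n + 1) (u n)
  refine ⟨_, hmono, ?_, fun n => ?_⟩
  · refine tendsto_of_tendsto_of_tendsto_of_le_of_le ?_ tendsto_const_nhds
      (fun n => (hlow n).le) (fun n => (u n).2.le)
    simpa using tendsto_one_div_add_atTop_nhds_zero_nat.const_sub b
  · cases n with
    | zero => exact hF3 0 _
    | succ n => exact hF3 (n + 1) _

theorem exists_dilation_near {p : ℝ} {ρ : Set ℝ} (hρ : ρ ⊆ Ico (0 : ℝ) 1) {K : Set ℂ}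
    (hKc : IsCompact K) (hKT : K ⊆ sphere (0 : ℂ) 1) (hKm : arcMeasure K = 0) (hK : K.Nonempty)
    {P : ℕ → ℂ[X]} (hP : ∀ q : ℂ[X], RatPoly q → ∃ j, P j = q) {f : HpSpace p}
    (hf : ∀ j s : ℕ, 1 ≤ s → ∃ r ∈ ρ, f ∈ UHp p K P j s r) {φ : ℂ → ℂ} (hφ : ContinuousOn φ K)
    {L : Set ℂ} (hL : IsCompact L) (hLb : L ⊆ ball (0 : ℂ) 1) {ε : ℝ} (hε : 0 < ε) {a : ℝ}
    (ha : a < 1) :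
    ∃ r ∈ ρ, a < r ∧ ∀ ζ ∈ K, ∀ z ∈ L, ‖f.1 ((r : ℂ) * (ζ - z) + z) - φ ζ‖ ≤ ε := by
  obtain ⟨w, hw, hwK⟩ := exists_mem_sphere_notMem_of_arcMeasure_eq_zero hKm
  have hε3 : 0 < ε / 3 := by positivity
  obtain ⟨q, hq⟩ := exists_polynomial_near_of_subset_sphere hKc hKT hw hwK hφ hε3
  obtain ⟨q', hq', hqq'⟩ := exists_ratPoly_near q hε3
  obtain ⟨j, rfl⟩ := hP q' hq'
  obtain ⟨R, hR1, hLR⟩ : ∃ R < 1, L ⊆ closedBall (0 : ℂ) R := by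
    rcases L.eq_empty_or_nonempty with rfl | hne
    · exact ⟨0, one_pos, empty_subset _⟩
    · obtain ⟨x, hx, hmax⟩ := hL.exists_isMaxOn hne continuous_norm.continuousOn
      exact ⟨‖x‖, by simpa using hLb hx, fun z hz => by simpa using hmax hz⟩
  obtain ⟨s₀, hs₀⟩ := exists_nat_one_div_lt (lt_min hε3 (sub_pos.2 hR1))
  obtain ⟨s, hs, hs1, r, hr, har, hU⟩ :=
    exists_mem_UHp_near_one hρ hKc hKT hK hP hf j (s₀ + 1) ha
  have hspos : (0 : ℝ) < s := by exact_mod_cast hs1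
  have hs' : 1 / (s : ℝ) < min (ε / 3) (1 - R) :=
    (one_div_le_one_div_of_le (by positivity) (by exact_mod_cast hs)).trans_lt hs₀
  refine ⟨r, hr, har, fun ζ hζ z hz => ?_⟩
  have hzs : ‖z‖ ≤ (s : ℝ) / ((s : ℝ) + 1) := by
    refine (mem_closedBall_zero_iff.1 (hLR hz)).trans ?_
    have h2 := hs'.trans_le (min_le_right _ _)
    rw [div_lt_iff₀ hspos] at h2
    rw [le_div_iff₀ (by positivity)]
    nlinarith
  have h1 := norm_sub_lt_of_mem_UHp hKc hKT (hρ hr) hU hζ hzs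
  have h2 := hqq' ζ (by simpa using (mem_sphere_zero_iff_norm.1 (hKT hζ)).le)
  have h3 := hq ζ hζ
  have h4 := hs'.trans_le (min_le_left _ _)
  have h5 := norm_sub_le_norm_sub_add_norm_sub (f.1 ((r : ℂ) * (ζ - z) + z)) ((P j).eval ζ) (φ ζ)
  have h6 := norm_sub_le_norm_sub_add_norm_sub ((P j).eval ζ) (q.eval ζ) (φ ζ)
  linarith

/-- Lemma (hardyint): `𝒱_{H^p}^K(𝔻,ρ) = ⋂_{j∈ℕ, s∈ℕ*} ⋃_{r∈ρ} U(j,s,r)`. -/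
theorem statement_1 (p : ℝ) (hp : 1 ≤ p)
    (ρ : Set ℝ) (hρ : ρ ⊆ Set.Ico (0:ℝ) 1) (hρ1 : AccPt (1:ℝ) (Filter.principal ρ))
    (K : Set ℂ) (hKc : IsCompact K) (hKT : K ⊆ Metric.sphere (0:ℂ) 1)
    (hKm : arcMeasure K = 0)
    (P : ℕ → Polynomial ℂ) (hP1 : ∀ j, RatPoly (P j))
    (hP2 : ∀ q : Polynomial ℂ, RatPoly q → ∃ j, P j = q) :
    VHp p ρ K = ⋂ j : ℕ, ⋂ s : ℕ, ⋂ (_ : 1 ≤ s), ⋃ r ∈ ρ, UHp p K P j s r := by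
  ext f
  simp only [mem_iInter, mem_iUnion, exists_prop]
  constructor
  · intro hf j s hs
    have hs' : (s : ℝ) / ((s : ℝ) + 1) < 1 := (div_lt_one (by positivity)).2 (lt_add_one _)
    obtain ⟨r, hr, -, -, hlim⟩ := hf (fun ζ => (P j).eval ζ) (by fun_prop)
      (closedBall 0 ((s : ℝ) / ((s : ℝ) + 1))) (isCompact_closedBall _ _)
      (closedBall_subset_ball hs')
    obtain ⟨n, hn⟩ := (hlim.eventually_lt_const
      (show (0 : ℝ) < 1 / (s : ℝ) from one_div_pos.2 (by exact_mod_cast hs))).exists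
    exact ⟨r n, hr n, hn⟩
  · intro hf φ hφ L hL hLb
    obtain ⟨r, hmono, hlim, hr⟩ := exists_strictMono_tendsto_of_forall_exists_gt (b := 1)
      (Q := fun n r => r ∈ ρ ∧ ∀ ζ ∈ K, ∀ z ∈ L,
        ‖f.1 ((r : ℂ) * (ζ - z) + z) - φ ζ‖ ≤ 1 / ((n : ℝ) + 1)) fun n a ha => by
      rcases K.eq_empty_or_nonempty with rfl | hK
      · obtain ⟨r, hr, har⟩ := hρ1.exists_mem_gt ha
        exact ⟨r, har, (hρ hr).2, hr, by simp⟩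
      · obtain ⟨r, hr, har, h⟩ := exists_dilation_near hρ hKc hKT hKm hK hP2 hf hφ hL hLb
          (Nat.one_div_pos_of_nat (n := n)) ha
        exact ⟨r, har, (hρ hr).2, hr, h⟩
    refine ⟨r, fun n => (hr n).1, hmono, hlim, squeeze_zero (fun n => ?_) (fun n => ?_)
      tendsto_one_div_add_atTop_nhds_zero_nat⟩
    · exact Real.iSup_nonneg fun ζ => Real.iSup_nonneg fun _ => Real.iSup_nonneg fun z =>
        Real.iSup_nonneg fun _ => norm_nonneg _
    · have h0 : (0 : ℝ) ≤ 1 / ((n : ℝ) + 1) := by positivity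
      exact Real.iSup_le (fun ζ => Real.iSup_le (fun hζ => Real.iSup_le (fun z =>
        Real.iSup_le (fun hz => (hr n).2 ζ hζ z hz) h0) h0) h0) h0
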